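/- arXiv:2409.00672 — 2 statements merged into one kernel-verified Lean document; each statement's English description precedes it below -/
import Mathlib

section
/- Suppose S=(s_i) is a q-ary negative orientable sequence of order n, with q ≥ 2 and n ≥ 2. Then the period of S is at most (q^n - q^{⌊n/2⌋} - q^{⌊(n-1)/2⌋} + 1)/2 if q is odd; at most (q^n - 2·q^{(n-1)/2})/2 - 1 if q is even and n is odd; and at most (q^n - q^{n/2})/2 - 1 if q is even and n is even. -/
/-- The window of `n` consecutive terms of the sequence `S` starting at index `i`. -/
def window (q n : ℕ) (S : ℤ → ZMod q) (i : ℤ) : Fin n → ZMod q :=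
  fun k => S (i + (k : ℕ))

/-- `S` is a `q`-ary `n`-window sequence of period `m`: it is periodic with period `m`
and no `n`-tuple appears more than once per period. -/
def IsNWindowSeq (q n m : ℕ) (S : ℤ → ZMod q) : Prop :=
  1 < q ∧ 1 < n ∧ 0 < m ∧ (∀ i : ℤ, S (i + (m : ℕ)) = S i) ∧
    ∀ i j : ℤ, window q n S i = window q n S j → (m : ℤ) ∣ i - j

/-- `S` is a negative orientable sequence of order `n` (an `NOS_q(n)`) with period `m`. -/
def IsNOS (q n m : ℕ) (S : ℤ → ZMod q) : Prop :=
  IsNWindowSeq q n m S ∧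
    ∀ i j : ℤ, window q n S i ≠ -((window q n S j) ∘ Fin.rev)

open Finset

section NegativeReverse

variable {q n : ℕ}

/-- The negative of the reverse of a tuple. -/
def negRev (u : Fin n → ZMod q) : Fin n → ZMod q := -(u ∘ Fin.rev)

lemma negRev_apply (u : Fin n → ZMod q) (i : Fin n) : negRev u i = -u i.rev := rfl

lemma negRev_negRev (u : Fin n → ZMod q) : negRev (negRev u) = u := by
  funext i
  simp [negRev_apply]

lemma negRev_cons (a : ZMod q) (v : Fin n → ZMod q) :
    negRev (Fin.cons a v : Fin (n + 1) → ZMod q) = Fin.snoc (negRev v) (-a) := by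
  funext i
  refine Fin.lastCases ?_ (fun j => ?_) i
  · simp [negRev_apply]
  · simp [negRev_apply, Fin.rev_castSucc]

/-- The tuple with first half `f`, second half the negative reverse of `f`, and `c` in the
middle when the length is odd. -/
def negPalindrome (n : ℕ) (c : ZMod q) (f : Fin (n / 2) → ZMod q) : Fin n → ZMod q := fun k =>
  if h : (k : ℕ) < n / 2 then f ⟨k, h⟩
  else if h : (k.rev : ℕ) < n / 2 then -f ⟨k.rev, h⟩ else c

lemma negRev_negPalindrome {c : ZMod q} (hc : -c = c) (f : Fin (n / 2) → ZMod q) :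
    negRev (negPalindrome n c f) = negPalindrome n c f := by
  funext k
  have hk := k.isLt
  have hr : (k.rev : ℕ) = n - (k + 1) := Fin.val_rev k
  by_cases h1 : (k : ℕ) < n / 2
  · have h2 : ¬ (k.rev : ℕ) < n / 2 := by omega
    simp only [negRev_apply, negPalindrome, Fin.rev_rev, dif_pos h1, dif_neg h2, neg_neg]
  · by_cases h2 : (k.rev : ℕ) < n / 2
    · simp only [negRev_apply, negPalindrome, dif_pos h2, dif_neg h1]
    · simp only [negRev_apply, negPalindrome, Fin.rev_rev, dif_neg h1, dif_neg h2, hc]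

lemma negPalindrome_injective (c : ZMod q) : Function.Injective (negPalindrome n c) := by
  intro f g hfg
  funext k
  have hk := k.isLt
  have := congrFun hfg ⟨k, by omega⟩
  simpa [negPalindrome] using this

lemma eq_of_negPalindrome_eq (hn : Odd n) {c d : ZMod q} {f g : Fin (n / 2) → ZMod q}
    (h : negPalindrome n c f = negPalindrome n d g) : c = d := by
  obtain ⟨t, rfl⟩ := hn
  have hrev : ((Fin.rev (⟨t, by omega⟩ : Fin (2 * t + 1)) : Fin (2 * t + 1)) : ℕ) = t := by
    rw [Fin.val_rev]
    dsimp only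
    omega
  have h1 : ¬ t < (2 * t + 1) / 2 := by omega
  have := congrFun h ⟨t, by omega⟩
  simpa only [negPalindrome, hrev, dif_neg h1] using this

variable (q n) in
/-- The tuples equal to their own negative reverse. -/
def negSymmetric [NeZero q] : Finset (Fin n → ZMod q) := {u | negRev u = u}

lemma mem_negSymmetric [NeZero q] {u : Fin n → ZMod q} :
    u ∈ negSymmetric q n ↔ negRev u = u := by
  simp [negSymmetric]

lemma pow_le_card_negSymmetric [NeZero q] : q ^ (n / 2) ≤ #(negSymmetric q n) := by
  have := card_le_card_of_injOn (s := univ) (t := negSymmetric q n) (negPalindrome n (0 : ZMod q))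
    (fun f _ => mem_negSymmetric.2 (negRev_negPalindrome neg_zero f))
    (negPalindrome_injective _).injOn
  simpa [card_univ, ZMod.card] using this

lemma two_mul_pow_le_card_negSymmetric [NeZero q] (hn : Odd n) {c : ZMod q} (hc : -c = c)
    (hc0 : c ≠ 0) : 2 * q ^ (n / 2) ≤ #(negSymmetric q n) := by
  have := card_le_card_of_injOn
    (s := ({0, c} : Finset (ZMod q)) ×ˢ (univ : Finset (Fin (n / 2) → ZMod q)))
    (t := negSymmetric q n) (fun p => negPalindrome n p.1 p.2)
    (fun p hp => mem_negSymmetric.2 (negRev_negPalindrome (by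
      simp only [coe_product, Set.mem_prod, mem_coe, mem_insert, mem_singleton] at hp
      rcases hp.1 with h | h <;> simp [h, hc]) p.2))
    (by
      rintro ⟨c₁, f⟩ - ⟨c₂, g⟩ - h
      obtain rfl : c₁ = c₂ := eq_of_negPalindrome_eq hn h
      obtain rfl : f = g := negPalindrome_injective _ h
      rfl)
  rw [card_product, card_pair hc0.symm] at this
  simpa [card_univ, ZMod.card] using this

/-- If `v` and `(a, v)` both equal their negative reverses, then `v` is constant. -/
lemma eq_const_of_negRev_cons {a : ZMod q} {v : Fin n → ZMod q} (hv : negRev v = v)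
    (h : negRev (Fin.cons a v : Fin (n + 1) → ZMod q) = Fin.cons a v) :
    (v = fun _ => a) ∧ -a = a := by
  rw [negRev_cons, hv] at h
  have key : ∀ j (hj : j < n + 1), (Fin.cons a v : Fin (n + 1) → ZMod q) ⟨j, hj⟩ = a := by
    intro j
    induction j with
    | zero => intro hj; rfl
    | succ j ih =>
      intro hj
      rw [← ih (by omega)]
      have h1 := congrFun h (Fin.castSucc ⟨j, by omega⟩)
      rw [Fin.snoc_castSucc] at h1
      exact h1
  have hlast := congrFun h (Fin.last n)
  rw [Fin.snoc_last] at hlast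
  exact ⟨funext fun j => key (j + 1) (by omega), hlast.trans (key n (by omega))⟩

end NegativeReverse

section Windows

variable {q n m : ℕ} {S : ℤ → ZMod q}

lemma window_succ_eq_cons (i : ℤ) :
    window q (n + 1) S i = Fin.cons (S i) (window q n S (i + 1)) := by
  funext j
  refine Fin.cases ?_ (fun j => ?_) j
  · simp [window]
  · simp only [window, Fin.cons_succ, Fin.val_succ]
    congr 1
    push_cast
    ring

lemma window_succ_eq_snoc (i : ℤ) :
    window q (n + 1) S i = Fin.snoc (window q n S i) (S (i + n)) := by
  funext j
  refine Fin.lastCases ?_ (fun j => ?_) j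
  · simp [window]
  · simp [window]

lemma IsNWindowSeq.eq_of_window_eq (h : IsNWindowSeq q n m S) {i j : ℤ}
    (hij : window q n S i = window q n S j) (t : ℤ) : S (i + t) = S (j + t) := by
  obtain ⟨-, -, -, hper, hinj⟩ := h
  obtain ⟨c, hc⟩ := hinj i j hij
  have hp : Function.Periodic S (m : ℤ) := hper
  have := (hp.int_mul c) (j + t)
  rw [← this]
  congr 1
  push_cast
  linarith

variable (n S) in
/-- The `n`-tuples occurring in `S`. -/
noncomputable def windows [NeZero q] : Finset (Fin n → ZMod q) := by
  classical exact {u | ∃ i, window q n S i = u}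

lemma mem_windows [NeZero q] {u : Fin n → ZMod q} :
    u ∈ windows n S ↔ ∃ i, window q n S i = u := by
  simp [windows]

lemma IsNWindowSeq.le_card_windows [NeZero q] (h : IsNWindowSeq q n m S) :
    m ≤ #(windows n S) := by
  have := card_le_card_of_injOn (s := range m) (t := windows n S)
    (fun i : ℕ => window q n S i) (fun i _ => mem_windows.2 ⟨i, rfl⟩) (by
      intro i hi j hj hij
      have hd := h.2.2.2.2 _ _ hij
      simp only [coe_range, Set.mem_Iio] at hi hj
      have := Int.eq_zero_of_abs_lt_dvd hd (by rw [abs_lt]; omega)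
      omega)
  simpa using this

/-- In an `n + 1`-window sequence, each `n`-tuple is preceded by as many symbols as it is
followed by. -/
lemma IsNWindowSeq.card_cons_eq_card_snoc [NeZero q] (h : IsNWindowSeq q (n + 1) m S)
    (v : Fin n → ZMod q) :
    #{a : ZMod q | (Fin.cons a v : Fin (n + 1) → ZMod q) ∈ windows (n + 1) S} =
      #{a : ZMod q | (Fin.snoc v (-a) : Fin (n + 1) → ZMod q) ∈ windows (n + 1) S} := by
  classical
  have hA : ∀ a : ZMod q, (Fin.cons a v : Fin (n + 1) → ZMod q) ∈ windows (n + 1) S ↔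
      ∃ i, S i = a ∧ window q n S (i + 1) = v := by
    intro a
    simp only [mem_windows, window_succ_eq_cons, Fin.cons_inj]
  have hB : ∀ a : ZMod q, (Fin.snoc v (-a) : Fin (n + 1) → ZMod q) ∈ windows (n + 1) S ↔
      ∃ i, window q n S (i + 1) = v ∧ S (i + 1 + n) = -a := by
    intro a
    simp only [mem_windows, window_succ_eq_snoc, Fin.snoc_inj]
    constructor
    · rintro ⟨i, hi⟩
      exact ⟨i - 1, by simpa using hi⟩
    · rintro ⟨i, hi⟩
      exact ⟨i + 1, hi⟩
  simp only [hA, hB]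
  refine le_antisymm
    (card_le_card_of_forall_subsingleton
      (fun a b => ∃ i, S i = a ∧ window q n S (i + 1) = v ∧ S (i + 1 + n) = -b) ?_ ?_)
    (card_le_card_of_forall_subsingleton
      (fun b a => ∃ i, S i = a ∧ window q n S (i + 1) = v ∧ S (i + 1 + n) = -b) ?_ ?_)
  · intro a ha
    obtain ⟨i, hi, hv⟩ := (mem_filter.1 ha).2
    exact ⟨-S (i + 1 + n), by simpa using ⟨i, hv, rfl⟩, i, hi, hv, by simp⟩
  · rintro b - a ⟨-, i, rfl, hi, hib⟩ a' ⟨-, j, rfl, hj, hjb⟩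
    have := h.eq_of_window_eq (i := i + 1) (j := j + 1)
      (by rw [window_succ_eq_snoc, window_succ_eq_snoc, hi, hj, hib, hjb]) (-1)
    simpa using this
  · intro b hb
    obtain ⟨i, hv, hi⟩ := (mem_filter.1 hb).2
    exact ⟨S i, by simpa using ⟨i, rfl, hv⟩, i, rfl, hv, hi⟩
  · rintro a - b ⟨-, i, hia, hi, hib⟩ b' ⟨-, j, hja, hj, hjb⟩
    have := h.eq_of_window_eq (i := i) (j := j)
      (by rw [window_succ_eq_cons, window_succ_eq_cons, hi, hj, hia, hja]) (1 + n)
    rw [← add_assoc, ← add_assoc, hib, hjb] at this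
    exact neg_injective this

variable (n S) in
/-- The `n`-tuples that occur in `S`, whose negative reverse occurs in `S`, or that are equal
to their negative reverse. -/
noncomputable def blocked [NeZero q] : Finset (Fin n → ZMod q) := by
  classical exact windows n S ∪ (windows n S).image negRev ∪ negSymmetric q n

lemma mem_image_negRev_windows [NeZero q] {u : Fin n → ZMod q} :
    u ∈ (windows n S).image negRev ↔ negRev u ∈ windows n S := by
  constructor
  · intro h
    obtain ⟨w, hw, rfl⟩ := mem_image.1 h
    rwa [negRev_negRev]
  · exact fun h => mem_image.2 ⟨_, h, negRev_negRev u⟩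

lemma mem_blocked [NeZero q] {u : Fin n → ZMod q} :
    u ∈ blocked n S ↔ u ∈ windows n S ∨ negRev u ∈ windows n S ∨ negRev u = u := by
  classical
  have := mem_image_negRev_windows (S := S) (u := u)
  simp only [blocked, mem_union, mem_negSymmetric, or_assoc]
  rw [← this]

lemma IsNOS.negRev_notMem_windows [NeZero q] (h : IsNOS q n m S) {u : Fin n → ZMod q}
    (hu : u ∈ windows n S) : negRev u ∉ windows n S := by
  intro hu'
  obtain ⟨i, rfl⟩ := mem_windows.1 hu
  obtain ⟨j, hj⟩ := mem_windows.1 hu'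
  exact h.2 j i hj

lemma IsNOS.two_mul_add_card_negSymmetric_le [NeZero q] (h : IsNOS q n m S) :
    2 * m + #(negSymmetric q n) ≤ #(blocked n S) := by
  classical
  have h1 : Disjoint (windows n S) ((windows n S).image negRev) :=
    disjoint_left.2 fun u hu hu' =>
      h.negRev_notMem_windows hu (mem_image_negRev_windows.1 hu')
  have h2 : Disjoint (windows n S ∪ (windows n S).image negRev) (negSymmetric q n) := by
    refine disjoint_left.2 fun u hu hu' => ?_
    have hs := mem_negSymmetric.1 hu'
    rcases mem_union.1 hu with hu | hu
    · exact h.negRev_notMem_windows hu (hs.symm ▸ hu)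
    · rw [mem_image_negRev_windows, hs] at hu
      exact h.negRev_notMem_windows hu (hs.symm ▸ hu)
  have h3 := h.1.le_card_windows
  have hc : #(blocked n S) = _ := card_union_of_disjoint h2
  rw [card_union_of_disjoint h1,
    card_image_of_injective _ (Function.LeftInverse.injective negRev_negRev)] at hc
  omega

/-- A parity obstruction: the symbols `a` for which `(a, v)` is blocked are the symbols making
it equal to its negative reverse, together with two disjoint sets of the same size. -/
lemma IsNOS.exists_cons_notMem_blocked [NeZero q] (h : IsNOS q (n + 1) m S)
    {v : Fin n → ZMod q} (hv : negRev v = v)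
    (hodd : Odd (q + #{a : ZMod q |
      negRev (Fin.cons a v : Fin (n + 1) → ZMod q) = Fin.cons a v})) :
    ∃ a : ZMod q, (Fin.cons a v : Fin (n + 1) → ZMod q) ∉ blocked (n + 1) S := by
  classical
  by_contra! hall
  have hAB := h.1.card_cons_eq_card_snoc v
  set A : Finset (ZMod q) := {a | (Fin.cons a v : Fin (n + 1) → ZMod q) ∈ windows (n + 1) S}
    with hA
  set B : Finset (ZMod q) :=
    {a | (Fin.snoc v (-a) : Fin (n + 1) → ZMod q) ∈ windows (n + 1) S} with hB
  set C : Finset (ZMod q) :=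
    {a | negRev (Fin.cons a v : Fin (n + 1) → ZMod q) = Fin.cons a v} with hC
  have hmemB : ∀ a, a ∈ B ↔
      negRev (Fin.cons a v : Fin (n + 1) → ZMod q) ∈ windows (n + 1) S := by
    intro a
    rw [negRev_cons, hv]
    simp [hB]
  have h1 : Disjoint A B := disjoint_left.2 fun a ha hb =>
    h.negRev_notMem_windows (mem_filter.1 ha).2 ((hmemB a).1 hb)
  have h2 : Disjoint (A ∪ B) C := by
    refine disjoint_left.2 fun a hab hc => ?_
    have hs := (mem_filter.1 hc).2
    rcases mem_union.1 hab with ha | hb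
    · have ha := (mem_filter.1 ha).2
      exact h.negRev_notMem_windows ha (hs.symm ▸ ha)
    · have hb := (hmemB a).1 hb
      rw [hs] at hb
      exact h.negRev_notMem_windows hb (hs.symm ▸ hb)
  have hU : A ∪ B ∪ C = univ := by
    refine eq_univ_of_forall fun a => ?_
    rw [mem_union, mem_union, hmemB, or_assoc]
    simpa [hA, hC] using mem_blocked.1 (hall a)
  have hcard := congrArg card hU
  rw [card_union_of_disjoint h2, card_union_of_disjoint h1, card_univ, ZMod.card, ← hAB] at hcard
  obtain ⟨t, ht⟩ := hodd
  omega

lemma IsNOS.two_mul_add_card_negSymmetric_add_card_le [NeZero q] (h : IsNOS q (n + 1) m S)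
    (V : Finset (Fin n → ZMod q))
    (hV : ∀ v ∈ V, ∃ a : ZMod q, (Fin.cons a v : Fin (n + 1) → ZMod q) ∉ blocked (n + 1) S) :
    2 * m + #(negSymmetric q (n + 1)) + #V ≤ q ^ (n + 1) := by
  classical
  have hle : #V ≤ #(blocked (n + 1) S)ᶜ := by
    refine card_le_card_of_forall_subsingleton
      (fun (v : Fin n → ZMod q) (u : Fin (n + 1) → ZMod q) => Fin.tail u = v) (fun v hv => ?_) ?_
    · obtain ⟨a, ha⟩ := hV v hv
      exact ⟨Fin.cons a v, mem_compl.2 ha, Fin.tail_cons _ _⟩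
    · rintro u - v ⟨-, rfl⟩ w ⟨-, rfl⟩
      rfl
  have hcard := card_add_card_compl (blocked (n + 1) S)
  have htot : Fintype.card (Fin (n + 1) → ZMod q) = q ^ (n + 1) := by simp [ZMod.card]
  have := h.two_mul_add_card_negSymmetric_le
  omega

lemma IsNOS.two_mul_add_le_of_odd [NeZero q] (h : IsNOS q (n + 1) m S) (hq : Odd q) :
    2 * m + q ^ ((n + 1) / 2) + q ^ (n / 2) ≤ q ^ (n + 1) + 1 := by
  classical
  have hneg : ∀ a : ZMod q, -a = a → a = 0 := fun a ha =>
    (ZMod.neg_eq_self_iff a).1 ha |>.resolve_right fun h2 => by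
      obtain ⟨t, ht⟩ := hq
      omega
  have key := h.two_mul_add_card_negSymmetric_add_card_le ((negSymmetric q n).erase 0) (by
    intro v hv
    obtain ⟨hv0, hv⟩ := mem_erase.1 hv
    rw [mem_negSymmetric] at hv
    refine h.exists_cons_notMem_blocked hv ?_
    rw [filter_false_of_mem]
    · simpa using hq
    · intro a _ ha
      obtain ⟨hva, ha⟩ := eq_const_of_negRev_cons hv ha
      rw [hneg a ha] at hva
      exact hv0 hva)
  have h0 : (0 : Fin n → ZMod q) ∈ negSymmetric q n :=
    mem_negSymmetric.2 (by funext i; simp [negRev_apply])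
  have h1 := card_erase_add_one h0
  have h2 := pow_le_card_negSymmetric (q := q) (n := n)
  have h3 := pow_le_card_negSymmetric (q := q) (n := n + 1)
  omega

lemma exists_ne_zero_neg_eq_self (hq0 : 0 < q) (hq : Even q) :
    ∃ c : ZMod q, -c = c ∧ c ≠ 0 := by
  obtain ⟨t, rfl⟩ := hq
  refine ⟨(t : ZMod (t + t)), ?_, ?_⟩
  · rw [neg_eq_iff_add_eq_zero]
    exact_mod_cast ZMod.natCast_self (t + t)
  · rw [Ne, ZMod.natCast_eq_zero_iff]
    intro hd
    have := Nat.le_of_dvd (by omega) hd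
    omega

lemma IsNOS.two_mul_add_card_negSymmetric_add_two_le [NeZero q] (h : IsNOS q (n + 1) m S)
    (hn : 0 < n) (hq : Even q) :
    2 * m + #(negSymmetric q (n + 1)) + 2 ≤ q ^ (n + 1) := by
  classical
  obtain ⟨c, hc, hc0⟩ := exists_ne_zero_neg_eq_self (NeZero.pos q) hq
  have hex : ∀ d : ZMod q, -d = d →
      ∃ a : ZMod q, (Fin.cons a (fun _ => d) : Fin (n + 1) → ZMod q) ∉ blocked (n + 1) S := by
    intro d hd
    have hv : negRev (fun _ : Fin n => d) = fun _ => d := funext fun _ => hd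
    refine h.exists_cons_notMem_blocked hv ?_
    have hs : ({a : ZMod q | negRev (Fin.cons a (fun _ => d) : Fin (n + 1) → ZMod q) =
        Fin.cons a (fun _ => d)} : Finset (ZMod q)) = {d} := by
      ext a
      simp only [mem_filter, mem_univ, true_and, mem_singleton]
      constructor
      · intro ha
        exact (congrFun (eq_const_of_negRev_cons hv ha).1 ⟨0, hn⟩).symm
      · rintro rfl
        have hconst : (Fin.cons a (fun _ => a) : Fin (n + 1) → ZMod q) = fun _ => a := by
          funext j
          refine Fin.cases rfl (fun _ => rfl) j
        rw [hconst]
        exact funext fun _ => hd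
    rw [hs, card_singleton]
    exact hq.add_one
  have hne : (fun _ : Fin n => (0 : ZMod q)) ≠ fun _ => c := fun he =>
    hc0 (congrFun he ⟨0, hn⟩).symm
  have key := h.two_mul_add_card_negSymmetric_add_card_le {fun _ => 0, fun _ => c} (by
    intro v hv
    rcases mem_insert.1 hv with rfl | hv
    · exact hex 0 neg_zero
    · rw [mem_singleton.1 hv]
      exact hex c hc)
  rwa [card_pair hne] at key

end Windows

/-- improved bound on the period of a negative orientable sequence. -/
theorem stmt5 (q n m : ℕ) (hq : 2 ≤ q) (hn : 2 ≤ n) (S : ℤ → ZMod q)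
    (hS : IsNOS q n m S) :
    (m : ℚ) ≤ (if Odd q then
        ((q : ℚ) ^ n - (q : ℚ) ^ (n / 2) - (q : ℚ) ^ ((n - 1) / 2) + 1) / 2
      else if Odd n then ((q : ℚ) ^ n - 2 * (q : ℚ) ^ ((n - 1) / 2)) / 2 - 1
      else ((q : ℚ) ^ n - (q : ℚ) ^ (n / 2)) / 2 - 1) := by
  have : NeZero q := ⟨by omega⟩
  obtain ⟨k, rfl⟩ : ∃ k, n = k + 1 := ⟨n - 1, by omega⟩
  rw [Nat.add_sub_cancel]
  split_ifs with hqo hno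
  · have : ((2 * m + q ^ ((k + 1) / 2) + q ^ (k / 2) : ℕ) : ℚ) ≤ (q ^ (k + 1) + 1 : ℕ) :=
      Nat.cast_le.2 (hS.two_mul_add_le_of_odd hqo)
    push_cast at this
    linarith
  · have hqe := Nat.not_odd_iff_even.1 hqo
    obtain ⟨c, hc, hc0⟩ := exists_ne_zero_neg_eq_self (NeZero.pos q) hqe
    have h1 := hS.two_mul_add_card_negSymmetric_add_two_le (by omega) hqe
    have h2 := two_mul_pow_le_card_negSymmetric hno hc hc0
    have hk : (k + 1) / 2 = k / 2 := by
      obtain ⟨t, ht⟩ := hno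
      omega
    rw [hk] at h2
    have : ((2 * m + 2 * q ^ (k / 2) + 2 : ℕ) : ℚ) ≤ (q ^ (k + 1) : ℕ) :=
      Nat.cast_le.2 (by omega)
    push_cast at this
    linarith
  · have h1 := hS.two_mul_add_card_negSymmetric_add_two_le (by omega) (Nat.not_odd_iff_even.1 hqo)
    have h2 := pow_le_card_negSymmetric (q := q) (n := k + 1)
    have : ((2 * m + q ^ ((k + 1) / 2) + 2 : ℕ) : ℚ) ≤ (q ^ (k + 1) : ℕ) :=
      Nat.cast_le.2 (by omega)
    push_cast at this
    linarith
end

section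
/- For all q > 2 and n ≥ 2, there exists a q-ary negative orientable sequence of order n whose period equals (q-1)^n/2 if q and n are both odd, and equals ((q-1)^n - k_{q,n,nq/2})/2 if q or n is even, where k_{q,n,w} denotes the number of zero-free q-ary n-tuples with weight exactly w. -/
/-- `k_{q,n,w}`: the number of zero-free `q`-ary `n`-tuples with weight exactly `w`. -/
noncomputable def kcount (q n : ℕ) (w : ℚ) : ℕ :=
  Nat.card {u : Fin n → ZMod q //
    (∀ i, u i ≠ 0) ∧ ((∑ i, (u i).val : ℕ) : ℚ) = w}

open Equiv

/-- Composing a permutation with a transposition of two points in different cycles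
attaches the first cycle to the second point. -/
theorem sameCycle_mul_swap_of_sameCycle {E : Type*} [Finite E] [DecidableEq E] {σ : Perm E}
    {a b x : E} (hab : ¬ σ.SameCycle a b) (hx : σ.SameCycle a x) :
    (σ * swap a b).SameCycle b x := by
  have key : ∀ k : ℕ, (σ * swap a b).SameCycle b ((σ ^ (k + 1)) a) := by
    intro k
    induction k with
    | zero => exact ⟨1, by simp⟩
    | succ k ih =>
      by_cases h : (σ ^ (k + 1)) a = a
      · rw [pow_succ', Perm.mul_apply, h]
        exact ⟨1, by simp⟩
      · have hb : (σ ^ (k + 1)) a ≠ b := fun hb => hab ⟨(k + 1 : ℕ), by rw [zpow_natCast, hb]⟩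
        have h1 : (σ ^ (k + 1 + 1)) a = (σ * swap a b) ((σ ^ (k + 1)) a) := by
          rw [pow_succ', Perm.mul_apply, Perm.mul_apply, swap_apply_of_ne_of_ne h hb]
        rw [h1]
        exact ih.apply_right
  obtain ⟨k, hk, -, rfl⟩ := hx.exists_pow_eq''
  obtain ⟨j, rfl⟩ := Nat.exists_eq_succ_of_ne_zero hk.ne'
  exact key j

/-- A directed-graph version of Euler's theorem. The edges `E` have sources `s` and targets `t`;
a decomposition `σ₀` of the edges into circuits is given, and a fixed edge `o` can be
reached from every edge. Then there is a circuit through all the edges. -/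
theorem exists_eulerian_perm {E V : Type*} [Fintype E] [DecidableEq E] (s t : E → V)
    (σ₀ : Perm E) (h₀ : ∀ e, s (σ₀ e) = t e) (o : E)
    (reach : ∀ O : Set E, o ∈ O → (∀ e f, t e = s f → f ∈ O → e ∈ O) → ∀ e, e ∈ O) :
    ∃ σ : Perm E, (∀ e, s (σ e) = t e) ∧ ∀ e, σ.SameCycle o e := by
  classical
  obtain ⟨σ, hσ, hmax⟩ := Finset.exists_max_image
    (Finset.univ.filter fun σ : Perm E => ∀ e, s (σ e) = t e)
    (fun σ => (Finset.univ.filter fun e => σ.SameCycle o e).card) ⟨σ₀, by simpa using h₀⟩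
  simp only [Finset.mem_filter, Finset.mem_univ, true_and] at hσ hmax
  refine ⟨σ, hσ, reach {e | σ.SameCycle o e} (Perm.SameCycle.refl _ _) ?_⟩
  intro e f hef hf
  by_contra he
  simp only [Set.mem_ofPred_eq] at hf he
  set g := σ.symm f with hg
  have hgf : σ g = f := by simp [hg]
  have hog : σ.SameCycle o g := by
    rw [← hgf] at hf
    exact Perm.sameCycle_apply_right.1 hf
  have hte : t g = t e := by rw [← hσ g, hgf, hef]
  have hge : ¬ σ.SameCycle g e := fun h => he (hog.trans h)
  have h1 : ∀ x, σ.SameCycle g x → (σ * swap g e).SameCycle e x :=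
    fun x => sameCycle_mul_swap_of_sameCycle hge
  have hmem : ∀ x, s ((σ * swap g e) x) = t x := by
    intro x
    rw [Perm.mul_apply, hσ]
    rcases eq_or_ne x g with rfl | hxg
    · rw [swap_apply_left, hte]
    rcases eq_or_ne x e with rfl | hxe
    · rw [swap_apply_right, hte]
    · rw [swap_apply_of_ne_of_ne hxg hxe]
  have hlt := hmax _ hmem
  refine absurd hlt (not_le.2 (Finset.card_lt_card ?_))
  have ho := h1 o hog.symm
  refine (Finset.ssubset_iff_of_subset ?_).2 ⟨e, by simpa using ho.symm, by simpa using he⟩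
  intro x hx
  simp only [Finset.mem_filter, Finset.mem_univ, true_and] at hx ⊢
  exact ho.symm.trans (h1 x (hog.symm.trans hx))

/-- The zero-free `q`-ary `n`-tuples of weight less than `n * q / 2`. -/
abbrev LightTuple (q n : ℕ) : Type :=
  {u : Fin n → ZMod q // (∀ i, u i ≠ 0) ∧ 2 * ∑ i, (u i).val < n * q}

theorem sum_val_neg_rev {q n : ℕ} [NeZero q] (u : Fin n → ZMod q) (hu : ∀ i, u i ≠ 0) :
    ∑ i, ((-(u ∘ Fin.rev)) i).val + ∑ i, (u i).val = n * q := by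
  have h : ∑ i, ((-(u ∘ Fin.rev)) i).val = ∑ i, (-(u i)).val :=
    Equiv.sum_comp Fin.revPerm fun i => (-(u i)).val
  rw [h, ← Finset.sum_add_distrib]
  have : ∀ i ∈ Finset.univ, (-(u i)).val + (u i).val = q := by
    intro i _
    have := ZMod.val_lt (u i)
    rw [ZMod.neg_val, if_neg (hu i)]
    omega
  rw [Finset.sum_congr rfl this]
  simp

theorem two_mul_card_lightTuple_add (q n : ℕ) [NeZero q] :
    2 * Fintype.card (LightTuple q n) + kcount q n ((n : ℚ) * q / 2) = (q - 1) ^ n := by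
  classical
  have hk : kcount q n ((n : ℚ) * q / 2) = (Finset.univ.filter fun u : Fin n → ZMod q =>
      (∀ i, u i ≠ 0) ∧ 2 * ∑ i, (u i).val = n * q).card := by
    rw [kcount, Nat.card_eq_fintype_card, Fintype.card_subtype]
    congr 1
    ext u
    simp only [Finset.mem_filter, Finset.mem_univ, true_and, and_congr_right_iff]
    intro _
    rw [eq_div_iff two_ne_zero, mul_comm]
    exact_mod_cast Iff.rfl
  have hheavy : (Finset.univ.filter fun u : Fin n → ZMod q =>
      (∀ i, u i ≠ 0) ∧ n * q < 2 * ∑ i, (u i).val).card = Fintype.card (LightTuple q n) := by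
    rw [Fintype.card_subtype]
    refine Finset.card_nbij' (fun u => -(u ∘ Fin.rev)) (fun u => -(u ∘ Fin.rev)) ?_ ?_ ?_ ?_
    · intro u hu
      simp only [Finset.coe_filter, Finset.mem_univ, true_and, Set.mem_ofPred_eq] at hu ⊢
      have := sum_val_neg_rev u hu.1
      exact ⟨fun i => by simpa using hu.1 _, by omega⟩
    · intro u hu
      simp only [Finset.coe_filter, Finset.mem_univ, true_and, Set.mem_ofPred_eq] at hu ⊢
      have := sum_val_neg_rev u hu.1
      exact ⟨fun i => by simpa using hu.1 _, by omega⟩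
    · intro u _
      ext i
      simp
    · intro u _
      ext i
      simp
  have htotal : (Finset.univ.filter fun u : Fin n → ZMod q => ∀ i, u i ≠ 0).card
      = (q - 1) ^ n := by
    have : (Finset.univ.filter fun u : Fin n → ZMod q => ∀ i, u i ≠ 0)
        = Fintype.piFinset fun _ => Finset.univ.erase 0 := by
      ext u
      simp [Fintype.mem_piFinset]
    rw [this, Fintype.card_piFinset]
    simp [ZMod.card]
  have hlight : Fintype.card (LightTuple q n) = (Finset.univ.filter fun u : Fin n → ZMod q =>
      (∀ i, u i ≠ 0) ∧ 2 * ∑ i, (u i).val < n * q).card := Fintype.card_subtype _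
  have hsplit := Finset.card_filter_add_card_filter_not
    (s := Finset.univ.filter fun u : Fin n → ZMod q => ∀ i, u i ≠ 0)
    (fun u => 2 * ∑ i, (u i).val < n * q)
  have hsplit' := Finset.card_filter_add_card_filter_not
    (s := Finset.univ.filter fun u : Fin n → ZMod q =>
      (∀ i, u i ≠ 0) ∧ ¬ 2 * ∑ i, (u i).val < n * q)
    (fun u => 2 * ∑ i, (u i).val = n * q)
  have heq : ∀ a : ℕ, (¬ a < n * q ∧ a = n * q) ↔ a = n * q := by omega
  have hgt : ∀ a : ℕ, (¬ a < n * q ∧ ¬ a = n * q) ↔ n * q < a := by omega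
  simp only [Finset.filter_filter, and_assoc, heq, hgt] at hsplit hsplit'
  omega

/-- There is a circuit through all light tuples in the de Bruijn graph. -/
theorem exists_lightTuple_perm (q p : ℕ) (hq : 2 < q) :
    ∃ (o : LightTuple q (p + 1)) (σ : Perm (LightTuple q (p + 1))),
      (∀ u i, (σ u).1 (Fin.castSucc i) = u.1 (Fin.succ i)) ∧ ∀ u, σ.SameCycle o u := by
  have : NeZero q := ⟨by omega⟩
  have : Fact (1 < q) := ⟨by omega⟩
  let o : LightTuple q (p + 1) := ⟨fun _ => 1, by simp, by
    simp only [ZMod.val_one, Finset.sum_const, Finset.card_univ, Fintype.card_fin, smul_eq_mul,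
      mul_one]
    nlinarith⟩
  let r : Perm (LightTuple q (p + 1)) :=
    ((finRotate (p + 1)).symm.arrowCongr (Equiv.refl (ZMod q))).subtypeEquiv (by
      intro u
      have h : ∑ i, (u (finRotate (p + 1) i)).val = ∑ i, (u i).val :=
        Equiv.sum_comp (finRotate (p + 1)) fun i => (u i).val
      simp only [Equiv.arrowCongr_apply, Equiv.symm_symm, Equiv.coe_refl, Function.comp_apply,
        id_eq, h]
      exact and_congr_left fun _ =>
        ((finRotate (p + 1)).forall_congr_right (q := fun i => u i ≠ 0)).symm)
  have hr : ∀ u, Fin.init (r u).1 = Fin.tail u.1 := by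
    intro u
    ext i
    simp [r, Fin.init, Fin.tail]
  suffices reach : ∀ O : Set (LightTuple q (p + 1)), o ∈ O →
      (∀ u v : LightTuple q (p + 1), Fin.tail u.1 = Fin.init v.1 → v ∈ O → u ∈ O) →
      ∀ u, u ∈ O by
    obtain ⟨σ, hσ, hc⟩ := exists_eulerian_perm (fun u : LightTuple q (p + 1) => Fin.init u.1)
      (fun u => Fin.tail u.1) r hr o reach
    exact ⟨o, σ, fun u i => congrFun (hσ u) i, hc⟩
  intro O ho hO
  have key : ∀ k : ℕ, ∀ u : LightTuple q (p + 1), (∀ i, k ≤ i.val → u.1 i = 1) → u ∈ O := by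
    intro k
    induction k with
    | zero =>
      intro u hu
      have : u = o := Subtype.ext (funext fun i => hu i (Nat.zero_le _))
      rwa [this]
    | succ k ih =>
      intro u hu
      have hpos : 1 ≤ (u.1 0).val := Nat.one_le_iff_ne_zero.2 (by simpa using u.2.1 0)
      let v : LightTuple q (p + 1) := ⟨Fin.snoc (α := fun _ => ZMod q) (Fin.tail u.1) 1, by
        constructor
        · intro i
          induction i using Fin.lastCases with
          | last => simp
          | cast i => simpa [Fin.tail] using u.2.1 _
        · have := u.2.2
          rw [Fin.sum_univ_succ] at this
          rw [Fin.sum_univ_castSucc]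
          simp only [Fin.snoc_castSucc, Fin.snoc_last, ZMod.val_one, Fin.tail]
          omega⟩
      refine hO u v (by simp [v]) (ih v ?_)
      intro i
      induction i using Fin.lastCases with
      | last => simp [v]
      | cast i =>
        intro hi
        simp only [v, Fin.snoc_castSucc, Fin.tail]
        exact hu _ (by simpa using hi)
  exact fun u => key (p + 1) u fun i hi => absurd i.2 (by omega)

/-- there exists an `NOS_q(n)` of period `(q-1)^n/2` if `q` and `n` are
both odd, and `((q-1)^n - k_{q,n,nq/2})/2` otherwise. -/
theorem stmt16 (q n : ℕ) (hq : 2 < q) (hn : 2 ≤ n) :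
    ∃ (m : ℕ) (S : ℤ → ZMod q), IsNOS q n m S ∧
      (m : ℚ) = (if Odd q ∧ Odd n then ((q : ℚ) - 1) ^ n / 2
        else (((q : ℚ) - 1) ^ n - kcount q n ((n : ℚ) * q / 2)) / 2) := by
  have : NeZero q := ⟨by omega⟩
  have hcard := two_mul_card_lightTuple_add q n
  obtain ⟨p, rfl⟩ : ∃ p, n = p + 1 := ⟨n - 1, by omega⟩
  obtain ⟨o, σ, hσ, hc⟩ := exists_lightTuple_perm q p hq
  have hcyc : σ.IsCycleOn (Finset.univ : Finset (LightTuple q (p + 1))) :=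
    ⟨by simp,
      fun x _ y _ => (hc x).symm.trans (hc y)⟩
  have hshift : ∀ (k : ℕ) (hk : k < p + 1) (u : LightTuple q (p + 1)),
      ((σ ^ k) u).1 0 = u.1 ⟨k, hk⟩ := by
    intro k
    induction k with
    | zero => intro hk u; rfl
    | succ k ih =>
      intro hk u
      rw [pow_succ, Perm.mul_apply, ih (by omega)]
      exact hσ u ⟨k, by omega⟩
  have hwin : ∀ i : ℤ, window q (p + 1) (fun i => ((σ ^ i) o).1 0) i = ((σ ^ i) o).1 := by
    intro i
    ext k
    rw [window, add_comm i, zpow_add, Perm.mul_apply, zpow_natCast, hshift k.1 k.2]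
  have hper : ∀ i : ℤ, (σ ^ i) o = o ↔ (Fintype.card (LightTuple q (p + 1)) : ℤ) ∣ i :=
    fun i => hcyc.zpow_apply_eq (Finset.mem_univ o)
  refine ⟨Fintype.card (LightTuple q (p + 1)), fun i => ((σ ^ i) o).1 0,
    ⟨⟨by omega, by omega, Fintype.card_pos_iff.2 ⟨o⟩, ?_, ?_⟩, ?_⟩, ?_⟩
  · intro i
    dsimp only
    rw [zpow_add, Perm.mul_apply, (hper _).2 dvd_rfl]
  · intro i j h
    rw [hwin, hwin] at h
    rw [← hper, sub_eq_neg_add, zpow_add, Perm.mul_apply, Subtype.ext h, ← Perm.mul_apply,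
      ← zpow_add]
    simp
  · intro i j h
    rw [hwin, hwin] at h
    have h1 := ((σ ^ i) o).2.2
    have h2 := ((σ ^ j) o).2.2
    have h3 := sum_val_neg_rev _ ((σ ^ j) o).2.1
    rw [← h] at h3
    omega
  · have hcast : 2 * (Fintype.card (LightTuple q (p + 1)) : ℚ)
        + kcount q (p + 1) (((p + 1 : ℕ) : ℚ) * q / 2) = ((q : ℚ) - 1) ^ (p + 1) := by
      have : ((q - 1 : ℕ) : ℚ) = (q : ℚ) - 1 := by
        rw [Nat.cast_sub (by omega), Nat.cast_one]
      rw [← this]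
      exact_mod_cast hcard
    split_ifs with hodd
    · have hk : kcount q (p + 1) (((p + 1 : ℕ) : ℚ) * q / 2) = 0 := by
        rw [kcount, Nat.card_eq_zero]
        refine Or.inl ⟨fun u => ?_⟩
        have h := u.2.2
        rw [eq_div_iff two_ne_zero] at h
        have h' : (∑ i, (u.1 i).val) * 2 = (p + 1) * q := by exact_mod_cast h
        exact Nat.not_even_iff_odd.2 (hodd.2.mul hodd.1) (h' ▸ even_two.mul_left _)
      rw [hk] at hcast
      push_cast at hcast
      linarith
    · linarith
end
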